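/- arXiv:2508.17549 — 4 statements merged into one kernel-verified Lean document; each statement's English description precedes it below -/
import Mathlib

section
/- Let K ⊆ ℝ² be a convex set, let V be a finite type, let f : V → ℝ² satisfy f v ∈ frontier K for every v, and let E be any set of unordered pairs of vertices. Let D ⊆ ℝ² be the union of the points f v for v ∈ V together with the closed segments from f u to f v over all pairs {u,v} ∈ E. Then there is a connected component U of the complement ℝ² \ D that is unbounded and satisfies f v ∈ closure U for every v ∈ V. (In words: in any straight-line drawing whose vertices all lie on a convex curve, every vertex lies on the boundary of the unbounded face, so the drawn graph is outerplanar.) -/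
open Set

/-- The closed segment representing an unordered pair of vertices under a
vertex placement `f`. -/
def edgeSegment {V : Type*} (f : V → EuclideanSpace ℝ (Fin 2)) :
    Sym2 V → Set (EuclideanSpace ℝ (Fin 2)) :=
  Sym2.lift ⟨fun u v => segment ℝ (f u) (f v), fun u v => segment_symm ℝ (f u) (f v)⟩

/-- An open half-space reaches every sphere about the origin that encloses one of its points. -/
theorem exists_norm_eq_of_lt_apply {F : Type*} [NormedAddCommGroup F] [NormedSpace ℝ F]
    [Nontrivial F] (φ : StrongDual ℝ F) {u R : ℝ} {x : F} (hx : u < φ x) (hR : ‖x‖ ≤ R) :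
    ∃ y, u < φ y ∧ ‖y‖ = R := by
  obtain ⟨v, hv, hφ⟩ : ∃ v : F, v ≠ 0 ∧ 0 ≤ φ v := by
    obtain ⟨w, hw⟩ := exists_ne (0 : F)
    rcases le_total 0 (φ w) with h | h
    · exact ⟨w, hw, h⟩
    · exact ⟨-w, neg_ne_zero.2 hw, by simpa using h⟩
  have hv' : 0 < ‖v‖ := norm_pos_iff.2 hv
  have hT : 0 ≤ (R + ‖x‖) / ‖v‖ := by
    have := norm_nonneg x
    have : 0 ≤ R + ‖x‖ := by linarith
    positivity
  have hcont : ContinuousOn (fun t : ℝ => ‖x + t • v‖) (Icc 0 ((R + ‖x‖) / ‖v‖)) := by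
    fun_prop
  have hmem : R ∈ Icc ‖x + (0 : ℝ) • v‖ ‖x + ((R + ‖x‖) / ‖v‖) • v‖ := by
    refine ⟨by simpa using hR, ?_⟩
    have h1 : ‖((R + ‖x‖) / ‖v‖) • v‖ = R + ‖x‖ := by
      rw [norm_smul, Real.norm_of_nonneg hT, div_mul_cancel₀ _ hv'.ne']
    have h2 := norm_sub_le (x + ((R + ‖x‖) / ‖v‖) • v) x
    rw [add_sub_cancel_left, h1] at h2
    linarith
  obtain ⟨t, ht, hy⟩ := intermediate_value_Icc hT hcont hmem
  refine ⟨x + t • v, ?_, hy⟩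
  have := mul_nonneg ht.1 hφ
  simp only [map_add, map_smul, smul_eq_mul]
  linarith

/-- In a real normed space of dimension greater than one, the complement of a bounded closed
convex set is preconnected. -/
theorem Convex.isPreconnected_compl_of_isBounded {F : Type*} [NormedAddCommGroup F]
    [NormedSpace ℝ F] (hF : 1 < Module.rank ℝ F) {C : Set F} (hC : Convex ℝ C)
    (hclosed : IsClosed C) (hbdd : Bornology.IsBounded C) : IsPreconnected Cᶜ := by
  have : Nontrivial F := (rank_pos_iff_nontrivial (R := ℝ)).1 (zero_lt_one.trans hF)
  obtain ⟨r, hr⟩ := hbdd.exists_norm_le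
  refine isPreconnected_of_forall_pair fun x hx y hy => ?_
  set R : ℝ := max (r + 1) (max ‖x‖ ‖y‖)
  obtain ⟨φ, a, hφ, hφx⟩ := geometric_hahn_banach_closed_point hC hclosed hx
  obtain ⟨ψ, b, hψ, hψy⟩ := geometric_hahn_banach_closed_point hC hclosed hy
  obtain ⟨p, hp, hpR⟩ := exists_norm_eq_of_lt_apply φ hφx
    ((le_max_left _ _).trans (le_max_right _ _) : ‖x‖ ≤ R)
  obtain ⟨q, hq, hqR⟩ := exists_norm_eq_of_lt_apply ψ hψy
    ((le_max_right _ _).trans (le_max_right _ _) : ‖y‖ ≤ R)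
  have hconn : ∀ (χ : StrongDual ℝ F) (c : ℝ), IsPreconnected {z | c < χ z} := fun χ c =>
    (convex_halfSpace_gt χ.toLinearMap.isLinear c).isPreconnected
  refine ⟨{z | a < φ z} ∪ Metric.sphere 0 R ∪ {z | b < ψ z}, ?_, Or.inl (Or.inl hφx),
    Or.inr hψy, ?_⟩
  · rintro z ((hz | hz) | hz) hzC
    · exact lt_asymm (hφ z hzC) hz
    · have h1 := hr z hzC
      rw [mem_sphere_zero_iff_norm] at hz
      have h2 : r + 1 ≤ R := le_max_left _ _
      linarith
    · exact lt_asymm (hψ z hzC) hz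
  · exact ((hconn φ a).union p hp (by simpa using hpR)
      (isPreconnected_sphere hF 0 R)).union q (Or.inr (by simpa using hqR)) hq (hconn ψ b)

/-- Taking the closure of a convex set in a finite-dimensional space does not change its
interior. -/
theorem Convex.interior_closure_eq_interior_of_finiteDimensional {F : Type*}
    [NormedAddCommGroup F] [NormedSpace ℝ F] [FiniteDimensional ℝ F] {K : Set F}
    (hK : Convex ℝ K) : interior (closure K) = interior K := by
  by_cases h : (interior K).Nonempty
  · exact hK.interior_closure_eq_interior_of_nonempty_interior h
  · refine (interior_mono subset_closure).antisymm' fun x hx => (h ?_).elim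
    rw [hK.interior_nonempty_iff_affineSpan_eq_top]
    have hspan := hK.closure.interior_nonempty_iff_affineSpan_eq_top.1 ⟨x, hx⟩
    rw [eq_top_iff, ← hspan, affineSpan_le]
    exact closure_minimal (subset_affineSpan ℝ K)
      (AffineSubspace.closed_of_finiteDimensional _)

/-- In any straight-line drawing whose vertices all lie on a convex curve
(the frontier of a convex set), there is an unbounded face (connected component
of the complement of the drawing) whose closure contains every vertex; in
particular the drawn graph is outerplanar. -/
theorem vertices_on_convex_curve_outerplanar
    (K : Set (EuclideanSpace ℝ (Fin 2))) (hK : Convex ℝ K)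
    {V : Type*} [Fintype V] (f : V → EuclideanSpace ℝ (Fin 2))
    (hf : ∀ v, f v ∈ frontier K) (E : Set (Sym2 V)) :
    ∃ U : Set (EuclideanSpace ℝ (Fin 2)),
      (∃ x ∈ (Set.range f ∪ ⋃ e ∈ E, edgeSegment f e)ᶜ,
        U = connectedComponentIn (Set.range f ∪ ⋃ e ∈ E, edgeSegment f e)ᶜ x) ∧
      ¬ Bornology.IsBounded U ∧ ∀ v, f v ∈ closure U := by
  set D := Set.range f ∪ ⋃ e ∈ E, edgeSegment f e
  set C := convexHull ℝ (Set.range f)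
  have hDC : D ⊆ C := by
    refine union_subset (subset_convexHull ℝ _) (iUnion₂_subset fun e _ => ?_)
    induction e using Sym2.ind with
    | _ u v => exact segment_subset_convexHull (mem_range_self u) (mem_range_self v)
  have hCcompact : IsCompact C := (Set.finite_range f).isCompact_convexHull ℝ
  have hCconvex : Convex ℝ C := convex_convexHull ℝ _
  have hCK : C ⊆ closure K :=
    convexHull_min (range_subset_iff.2 fun v => (hf v).1) hK.closure
  have hpre : IsPreconnected Cᶜ := hCconvex.isPreconnected_compl_of_isBounded
    (by rw [← Module.finrank_eq_rank]; norm_num) hCcompact.isClosed hCcompact.isBounded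
  obtain ⟨x, hx⟩ : Cᶜ.Nonempty := nonempty_compl.2 hCcompact.ne_univ
  have hsub : Cᶜ ⊆ connectedComponentIn Dᶜ x :=
    hpre.subset_connectedComponentIn hx (compl_subset_compl.2 hDC)
  refine ⟨connectedComponentIn Dᶜ x, ⟨x, fun h => hx (hDC h), rfl⟩, fun hbdd => ?_,
    fun v => closure_mono hsub ?_⟩
  · refine NormedSpace.unbounded_univ ℝ (EuclideanSpace ℝ (Fin 2)) ?_
    rw [← union_compl_self C]
    exact hCcompact.isBounded.union (hbdd.subset hsub)
  · rw [closure_compl]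
    intro hv
    refine (hf v).2 ?_
    rw [← hK.interior_closure_eq_interior_of_finiteDimensional]
    exact interior_mono hCK hv
end

section
/- Let K ⊆ ℝ² be a convex set and let p, q, r ∈ frontier K be affinely independent points such that each of the open segments openSegment ℝ p q, openSegment ℝ q r, openSegment ℝ r p has nonempty intersection with interior K. Let g = (1/3) • (p + q + r) be the centroid. Then there exists ε₀ > 0 such that for every ε with 0 < ε < ε₀, writing h x = g + (1 + ε) • (x − g) for the homothety of ratio 1 + ε about g: the points h p, h q, h r all lie outside closure K, and each of the open segments openSegment ℝ (h p) (h q), openSegment ℝ (h q) (h r), openSegment ℝ (h r) (h p) has nonempty intersection with interior K. -/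
open Set

open Topology

section ConvexHomothety

variable {E : Type*} [AddCommGroup E] [Module ℝ E] [TopologicalSpace E]
  [IsTopologicalAddGroup E] [ContinuousSMul ℝ E]

/-- The centroid of three points of the closure of a convex set is interior as soon as the open
segment between two of them meets the interior. -/
theorem Convex.centroid_mem_interior {K : Set E} (hK : Convex ℝ K) {p q r : E}
    (hp : p ∈ closure K) (hq : q ∈ closure K) (hr : r ∈ closure K)
    (hpq : (openSegment ℝ p q ∩ interior K).Nonempty) :
    ((1 : ℝ) / 3) • (p + q + r) ∈ interior K := by
  obtain ⟨_, ⟨a, b, ha, hb, hab, rfl⟩, hm⟩ := hpq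
  have hy : ((1 : ℝ) / 2) • (b • p + a • q) + ((1 : ℝ) / 2) • r ∈ closure K :=
    hK.closure (hK.closure hp hq hb.le ha.le (by linarith)) hr (by norm_num) (by norm_num)
      (by norm_num)
  have h := hK.combo_interior_closure_mem_interior hm hy (a := 1 / 3) (b := 2 / 3)
    (by norm_num) (by norm_num) (by norm_num)
  convert h using 1
  obtain rfl : b = 1 - a := by linarith
  module

/-- A homothety of ratio greater than one about an interior point of a convex set moves the
frontier points out of the closure. -/
theorem Convex.homothety_notMem_closure {K : Set E} (hK : Convex ℝ K) {g x : E}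
    (hg : g ∈ interior K) (hx : x ∈ frontier K) {ε : ℝ} (hε : 0 < ε) :
    g + (1 + ε) • (x - g) ∉ closure K := by
  intro h
  have h1 : 0 < 1 + ε := by linarith
  apply hx.2
  have := hK.combo_interior_closure_mem_interior hg h (a := ε / (1 + ε)) (b := 1 / (1 + ε))
    (by positivity) (by positivity) (by field_simp; ring)
  convert this using 1
  match_scalars <;> field_simp
  ring

/-- If an open segment meets an open set, so do its images under homotheties of ratio close
to one. -/
theorem IsOpen.eventually_homothety_openSegment_inter_nonempty {U : Set E} (hU : IsOpen U)
    (g : E) {x y : E} (h : (openSegment ℝ x y ∩ U).Nonempty) :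
    ∀ᶠ ε : ℝ in 𝓝 0,
      (openSegment ℝ (g + (1 + ε) • (x - g)) (g + (1 + ε) • (y - g)) ∩ U).Nonempty := by
  obtain ⟨_, ⟨a, b, ha, hb, hab, rfl⟩, hm⟩ := h
  have hc : Continuous fun ε : ℝ => g + (1 + ε) • (a • x + b • y - g) := by fun_prop
  filter_upwards [hc.continuousAt.eventually_mem (hU.mem_nhds (by simpa using hm))] with ε hε
  refine ⟨_, ⟨a, b, ha, hb, hab, ?_⟩, hε⟩
  obtain rfl : b = 1 - a := by linarith
  module

end ConvexHomothety

/-- A triangle inscribed in a convex curve, scaled slightly about its centroid,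
has all vertices outside the closure of the convex set, while each of its open
edges still meets the interior of the set. -/
theorem scaled_inscribed_triangle
    (K : Set (EuclideanSpace ℝ (Fin 2))) (hK : Convex ℝ K)
    (p q r : EuclideanSpace ℝ (Fin 2))
    (hp : p ∈ frontier K) (hq : q ∈ frontier K) (hr : r ∈ frontier K)
    (hind : AffineIndependent ℝ ![p, q, r])
    (hpq : (openSegment ℝ p q ∩ interior K).Nonempty)
    (hqr : (openSegment ℝ q r ∩ interior K).Nonempty)
    (hrp : (openSegment ℝ r p ∩ interior K).Nonempty) :
    ∃ ε₀ > (0 : ℝ), ∀ ε : ℝ, 0 < ε → ε < ε₀ →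
      let g : EuclideanSpace ℝ (Fin 2) := ((1 : ℝ) / 3) • (p + q + r)
      let h : EuclideanSpace ℝ (Fin 2) → EuclideanSpace ℝ (Fin 2) :=
        fun x => g + (1 + ε) • (x - g)
      h p ∉ closure K ∧ h q ∉ closure K ∧ h r ∉ closure K ∧
      (openSegment ℝ (h p) (h q) ∩ interior K).Nonempty ∧
      (openSegment ℝ (h q) (h r) ∩ interior K).Nonempty ∧
      (openSegment ℝ (h r) (h p) ∩ interior K).Nonempty := by
  have hg := hK.centroid_mem_interior hp.1 hq.1 hr.1 hpq
  obtain ⟨ε₀, hε₀, hball⟩ := Metric.eventually_nhds_iff.1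
    ((isOpen_interior.eventually_homothety_openSegment_inter_nonempty _ hpq).and
      ((isOpen_interior.eventually_homothety_openSegment_inter_nonempty _ hqr).and
        (isOpen_interior.eventually_homothety_openSegment_inter_nonempty _ hrp)))
  refine ⟨ε₀, hε₀, fun ε hε hlt => ?_⟩
  exact ⟨hK.homothety_notMem_closure hg hp hε, hK.homothety_notMem_closure hg hq hε,
    hK.homothety_notMem_closure hg hr hε, hball (by simpa [abs_of_pos hε] using hlt)⟩
end

section
/- Let K ⊆ ℝ² be a convex set and let γ : ℝ → ℝ² satisfy Set.range γ ⊆ closure K. Let t₁, t₂, t₃ be real numbers such that γ is differentiable at each tᵢ, the three points γ t₁, γ t₂, γ t₃ are pairwise distinct, lie in frontier K, and are collinear (Collinear ℝ {γ t₁, γ t₂, γ t₃}). Then for each i ∈ {1,2,3}, the derivative deriv γ tᵢ lies in the linear span Submodule.span ℝ {γ t₂ − γ t₁}. (In words: if three distinct points of a differentiable curve lying on a convex curve are collinear, then the tangent vectors at all three points are parallel to the common line; contrapositively, points of a smooth convex curve with pairwise non-parallel tangents are in general position.) -/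
open Set

/-- A convex set in a finite-dimensional space has a supporting hyperplane at every point of its
frontier. -/
theorem Convex.exists_supporting_functional_of_mem_frontier
    {E : Type*} [NormedAddCommGroup E] [NormedSpace ℝ E] [FiniteDimensional ℝ E]
    {K : Set E} (hK : Convex ℝ K) {b : E} (hb : b ∈ frontier K) :
    ∃ f : StrongDual ℝ E, f ≠ 0 ∧ ∀ x ∈ closure K, f x ≤ f b := by
  suffices h : ∃ f : StrongDual ℝ E, f ≠ 0 ∧ ∀ x ∈ K, f x ≤ f b by
    obtain ⟨f, hf0, hf⟩ := h
    exact ⟨f, hf0, fun x hx ↦ closure_minimal (t := {x | f x ≤ f b}) hf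
      (isClosed_le f.continuous continuous_const) hx⟩
  by_cases hint : (interior K).Nonempty
  · exact geometric_hahn_banach_of_nonempty_interior_point hK hb.2 hint
  have hKne : K.Nonempty := closure_nonempty_iff.1 ⟨b, hb.1⟩
  rw [hK.interior_nonempty_iff_affineSpan_eq_top,
    AffineSubspace.affineSpan_eq_top_iff_vectorSpan_eq_top_of_nonempty ℝ E E hKne] at hint
  obtain ⟨g, hg0, hg⟩ := Submodule.exists_le_ker_of_lt_top _ (lt_top_iff_ne_top.2 hint)
  let f : StrongDual ℝ E := LinearMap.toContinuousLinearMap g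
  have hconst : ∀ x ∈ K, ∀ y ∈ K, f y = f x := fun x hx y hy ↦ by
    have h : g (y - x) = 0 := hg (vsub_mem_vectorSpan ℝ hy hx)
    simpa [f, sub_eq_zero] using h
  refine ⟨f, fun h ↦ hg0 (by ext x; exact DFunLike.congr_fun h x), fun x hx ↦ ?_⟩
  have hbx : b ∈ {y | f y = f x} :=
    closure_minimal (hconst x hx) (isClosed_eq f.continuous continuous_const) hb.1
  exact hbx.ge

/-- A supporting functional at a point strictly between two points of the closure of a convex set
takes the same value at all three points. -/
theorem Convex.exists_supporting_functional_of_wbtw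
    {E : Type*} [NormedAddCommGroup E] [NormedSpace ℝ E] [FiniteDimensional ℝ E]
    {K : Set E} (hK : Convex ℝ K) {a b c : E} (ha : a ∈ closure K) (hb : b ∈ frontier K)
    (hc : c ∈ closure K) (hab : a ≠ b) (hbc : b ≠ c) (h : Wbtw ℝ a b c) :
    ∃ f : StrongDual ℝ E, f ≠ 0 ∧ (∀ x ∈ closure K, f x ≤ f b) ∧ f a = f b ∧ f c = f b := by
  obtain ⟨f, hf0, hf⟩ := hK.exists_supporting_functional_of_mem_frontier hb
  refine ⟨f, hf0, hf, ?_⟩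
  have hfa := hf a ha
  have hfc := hf c hc
  obtain ⟨r, ⟨hr0, hr1⟩, rfl⟩ := h
  have hr0 : 0 < r := hr0.lt_of_ne fun h ↦ hab (by simp [← h])
  have hr1 : r < 1 := hr1.lt_of_ne fun h ↦ hbc (by simp [h])
  simp only [AffineMap.lineMap_apply_module, map_add, map_smul, smul_eq_mul] at *
  have hac : f a ≤ f c := by nlinarith
  have hca : f c ≤ f a := by nlinarith
  constructor <;> nlinarith

/-- In the plane, the kernel of a nonzero functional is spanned by any nonzero vector in it. -/
theorem mem_span_singleton_of_apply_eq_zero {𝕜 E : Type*} [Field 𝕜] [AddCommGroup E] [Module 𝕜 E]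
    (hE : Module.finrank 𝕜 E = 2) {f : Module.Dual 𝕜 E} (hf : f ≠ 0) {v w : E} (hv0 : v ≠ 0)
    (hv : f v = 0) (hw : f w = 0) : w ∈ Submodule.span 𝕜 {v} := by
  have : FiniteDimensional 𝕜 E := Module.finite_of_finrank_eq_succ hE
  have hker := f.finrank_ker_add_one_of_ne_zero hf
  have hspan : Submodule.span 𝕜 {v} = LinearMap.ker f :=
    Submodule.eq_of_le_of_finrank_eq (by simpa using hv) (by
      rw [finrank_span_singleton hv0]; omega)
  rw [hspan]
  exact hw

/-- If a continuous functional attains its maximum along a curve at `t`, it vanishes on the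
velocity at `t`. -/
theorem apply_deriv_eq_zero_of_forall_le {E : Type*} [NormedAddCommGroup E] [NormedSpace ℝ E]
    {γ : ℝ → E} {t : ℝ} (hd : DifferentiableAt ℝ γ t) {f : StrongDual ℝ E}
    (hf : ∀ s, f (γ s) ≤ f (γ t)) : f (deriv γ t) = 0 :=
  IsLocalMax.hasDerivAt_eq_zero (Filter.Eventually.of_forall hf)
    (f.hasFDerivAt.comp_hasDerivAt t hd.hasDerivAt)

/-- If three distinct collinear points of a differentiable curve lie on the
frontier of a convex set containing the curve's range in its closure, then the
tangent vectors at all three points are parallel to the common line. -/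
theorem collinear_frontier_points_parallel_tangents
    (K : Set (EuclideanSpace ℝ (Fin 2))) (hK : Convex ℝ K)
    (γ : ℝ → EuclideanSpace ℝ (Fin 2)) (hγK : Set.range γ ⊆ closure K)
    (t₁ t₂ t₃ : ℝ)
    (hd₁ : DifferentiableAt ℝ γ t₁) (hd₂ : DifferentiableAt ℝ γ t₂)
    (hd₃ : DifferentiableAt ℝ γ t₃)
    (h12 : γ t₁ ≠ γ t₂) (h13 : γ t₁ ≠ γ t₃) (h23 : γ t₂ ≠ γ t₃)
    (hf₁ : γ t₁ ∈ frontier K) (hf₂ : γ t₂ ∈ frontier K) (hf₃ : γ t₃ ∈ frontier K)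
    (hcol : Collinear ℝ ({γ t₁, γ t₂, γ t₃} : Set (EuclideanSpace ℝ (Fin 2)))) :
    deriv γ t₁ ∈ Submodule.span ℝ ({γ t₂ - γ t₁} : Set (EuclideanSpace ℝ (Fin 2))) ∧
    deriv γ t₂ ∈ Submodule.span ℝ ({γ t₂ - γ t₁} : Set (EuclideanSpace ℝ (Fin 2))) ∧
    deriv γ t₃ ∈ Submodule.span ℝ ({γ t₂ - γ t₁} : Set (EuclideanSpace ℝ (Fin 2))) := by
  have hmem : ∀ t, γ t ∈ closure K := fun t ↦ hγK ⟨t, rfl⟩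
  obtain ⟨f, hf0, hf, h2, h3⟩ : ∃ f : StrongDual ℝ (EuclideanSpace ℝ (Fin 2)), f ≠ 0 ∧
      (∀ x ∈ closure K, f x ≤ f (γ t₁)) ∧ f (γ t₂) = f (γ t₁) ∧ f (γ t₃) = f (γ t₁) := by
    rcases hcol.wbtw_or_wbtw_or_wbtw with h | h | h
    · obtain ⟨f, hf0, hf, h1, h3⟩ := hK.exists_supporting_functional_of_wbtw
        (hmem t₁) hf₂ (hmem t₃) h12 h23 h
      exact ⟨f, hf0, by rwa [h1], h1.symm, h3.trans h1.symm⟩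
    · obtain ⟨f, hf0, hf, h2, h1⟩ := hK.exists_supporting_functional_of_wbtw
        (hmem t₂) hf₃ (hmem t₁) h23 h13.symm h
      exact ⟨f, hf0, by rwa [h1], h2.trans h1.symm, h1.symm⟩
    · obtain ⟨f, hf0, hf, h3, h2⟩ := hK.exists_supporting_functional_of_wbtw
        (hmem t₃) hf₁ (hmem t₂) h13.symm h12 h
      exact ⟨f, hf0, hf, h2, h3⟩
  have key : ∀ t, DifferentiableAt ℝ γ t → f (γ t) = f (γ t₁) →
      deriv γ t ∈ Submodule.span ℝ {γ t₂ - γ t₁} := fun t hd ht ↦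
    mem_span_singleton_of_apply_eq_zero (f := f.toLinearMap) finrank_euclideanSpace_fin
      (fun h ↦ hf0 (ContinuousLinearMap.coe_injective h)) (sub_ne_zero.2 h12.symm)
      (by simp [h2])
      (apply_deriv_eq_zero_of_forall_le hd fun s ↦ (hf _ (hmem s)).trans ht.ge)
  exact ⟨key t₁ hd₁ rfl, key t₂ hd₂ h2, key t₃ hd₃ h3⟩
end

section
/- Let K ⊆ ℝ² be a compact convex set with nonempty interior that is smooth in the following sense: for every x ∈ frontier K and every pair of nonzero linear functionals φ, ψ : ℝ² → ℝ satisfying φ y ≤ φ x for all y ∈ K and ψ y ≤ ψ x for all y ∈ K, there exists c > 0 with ψ = c • φ (i.e., K has a unique supporting line at each frontier point). Let u, v ∈ ℝ² with u ∉ K, v ∉ K, and openSegment ℝ u v ∩ interior K ≠ ∅. Then there exists w ∈ ℝ² with w ∉ K, ¬Collinear ℝ {u, v, w}, openSegment ℝ u w ∩ interior K ≠ ∅, and openSegment ℝ w v ∩ interior K ≠ ∅. -/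
open Set

open Filter Topology

/-- The segments from `u` to `w` and from `p` to `z` cross when `p` lies on the side `uq` and `w`
on the side `qz` of the triangle `uqz`. -/
theorem openSegment_inter_openSegment_of_mem {E : Type*} [AddCommGroup E] [Module ℝ E]
    {u q z p w : E} (hp : p ∈ openSegment ℝ u q) (hw : w ∈ openSegment ℝ q z) :
    (openSegment ℝ u w ∩ openSegment ℝ p z).Nonempty := by
  rw [openSegment_eq_image] at hp hw
  obtain ⟨r, ⟨hr0, hr1⟩, rfl⟩ := hp
  obtain ⟨t, ⟨ht0, ht1⟩, rfl⟩ := hw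
  have hd : 0 < 1 - t + t * r := by nlinarith [mul_pos ht0 hr0]
  refine ⟨(1 - r / (1 - t + t * r)) • u + (r / (1 - t + t * r)) • ((1 - t) • q + t • z), ?_, ?_⟩
  · rw [openSegment_eq_image]
    refine ⟨r / (1 - t + t * r), ⟨by positivity, ?_⟩, rfl⟩
    rw [div_lt_one hd]
    nlinarith [mul_pos (sub_pos.2 hr1) (sub_pos.2 ht1)]
  · rw [openSegment_eq_image]
    refine ⟨t * r / (1 - t + t * r), ⟨by positivity, ?_⟩, ?_⟩
    · rw [div_lt_one hd]
      linarith
    · match_scalars <;> field_simp <;> ring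

/-- The tangent line from an exterior point `u`, found by maximising the slope `L / M` over `K`. -/
theorem exists_tangent_functional {E : Type*} [AddCommGroup E] [Module ℝ E] [TopologicalSpace E]
    [IsTopologicalAddGroup E] {K : Set E} (hK : IsCompact K) (L M : E →L[ℝ] ℝ) (u : E)
    (hM : ∀ y ∈ K, 0 < M (y - u)) (hL : ∃ y ∈ K, 0 < L (y - u)) :
    ∃ a > 0, ∃ p ∈ K, L (p - u) = a * M (p - u) ∧ ∀ y ∈ K, L (y - u) ≤ a * M (y - u) := by
  obtain ⟨y₀, hy₀, hLy₀⟩ := hL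
  obtain ⟨p, hp, hmax⟩ := hK.exists_isMaxOn ⟨y₀, hy₀⟩
    (f := fun y => L (y - u) / M (y - u))
    (ContinuousOn.div (by fun_prop) (by fun_prop) fun y hy => (hM y hy).ne')
  have hle : ∀ y ∈ K, L (y - u) / M (y - u) ≤ L (p - u) / M (p - u) := fun y hy => hmax hy
  refine ⟨L (p - u) / M (p - u), (div_pos hLy₀ (hM y₀ hy₀)).trans_le (hle y₀ hy₀), p, hp, ?_,
    fun y hy => ?_⟩
  · exact (div_mul_cancel₀ _ (hM p hp).ne').symm
  · exact (div_le_iff₀ (hM y hy)).1 (hle y hy)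

/-- A point `u` outside a closed convex set `K` is separated from `K` by a line through `u`,
written in the coordinates `S, L`, provided the ray from `u` in direction `e` meets `K`. -/
theorem exists_separating_coordinate {E : Type*} [NormedAddCommGroup E] [NormedSpace ℝ E]
    {K : Set E} (hKc : IsClosed K) (hK : Convex ℝ K) {S L : E →L[ℝ] ℝ} {e f : E}
    (hdec : ∀ x, x = S x • e + L x • f) {u z : E} (hu : u ∉ K) (hz : z ∈ K)
    (hLz : L (z - u) = 0) (hSz : 0 < S (z - u)) :
    ∃ m : ℝ, ∀ y ∈ K, 0 < (S + m • L) (y - u) := by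
  obtain ⟨g, c, hgu, hg⟩ := geometric_hahn_banach_point_closed hK hKc hu
  have hpos : ∀ y ∈ K, 0 < S (y - u) * g e + L (y - u) * g f := fun y hy => by
    have h : g (y - u) = S (y - u) * g e + L (y - u) * g f := by
      conv_lhs => rw [hdec (y - u)]
      simp
    rw [← h, map_sub]
    linarith [hg y hy]
  have hge : 0 < g e := by
    have := hpos z hz
    rw [hLz, zero_mul, add_zero] at this
    exact pos_of_mul_pos_right this hSz.le
  refine ⟨g f / g e, fun y hy => ?_⟩
  have := div_pos (hpos y hy) hge
  simp only [add_apply, smul_apply, smul_eq_mul]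
  rwa [add_div, mul_div_cancel_right₀ _ hge.ne', mul_div_assoc, mul_comm (L _)] at this

/-- The apex on the side `0 < L` of the line `uv`: if the separating lines through `u` and `v` do
not converge on the other side, then the tangent lines from `u` and `v` meet on this side. -/
theorem exists_apex_of_nonpos {E : Type*} [NormedAddCommGroup E] [NormedSpace ℝ E]
    {K : Set E} (hKc : IsCompact K) (hK : Convex ℝ K)
    (hsmooth : ∀ x ∈ frontier K,
      ∀ φ ψ : E →ₗ[ℝ] ℝ, φ ≠ 0 → ψ ≠ 0 →
        (∀ y ∈ K, φ y ≤ φ x) → (∀ y ∈ K, ψ y ≤ ψ x) → ∃ c > (0 : ℝ), ψ = c • φ)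
    {S L : E →L[ℝ] ℝ} {e f : E} (hdec : ∀ x, x = S x • e + L x • f)
    (hSe : S e = 1) (hSf : S f = 0) (hLe : L e = 0) (hLf : L f = 1)
    {u v z : E} (hv : v = u + e) (hz : z ∈ interior K) (hLz : L (z - u) = 0) {m n : ℝ}
    (hm : ∀ y ∈ K, 0 < (S + m • L) (y - u)) (hn : ∀ y ∈ K, 0 < (-S + n • L) (y - v))
    (hmn : m + n ≤ 0) :
    ∃ w, w ∉ K ∧ 0 < L (w - u) ∧ (openSegment ℝ u w ∩ interior K).Nonempty ∧
      (openSegment ℝ w v ∩ interior K).Nonempty := by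
  have hSv : ∀ y, S (y - v) = S (y - u) - 1 := fun y => by
    rw [hv, ← sub_sub, map_sub, hSe]
  have hLv : ∀ y, L (y - v) = L (y - u) := fun y => by
    rw [hv, ← sub_sub, map_sub, hLe, sub_zero]
  have hinj : ∀ x y, S (x - u) = S (y - u) → L (x - u) = L (y - u) → x = y := fun x y h₁ h₂ => by
    rw [← sub_left_inj (a := u), hdec (x - u), hdec (y - u), h₁, h₂]
  have hL : ∃ y ∈ K, 0 < L (y - u) := by
    have htend : Tendsto (fun t : ℝ => z + t • f) (𝓝[>] 0) (𝓝 z) := by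
      have : ContinuousAt (fun t : ℝ => z + t • f) 0 := by fun_prop
      simpa [ContinuousAt] using this.tendsto.mono_left nhdsWithin_le_nhds
    obtain ⟨t, ht, ht0⟩ := ((htend.eventually (isOpen_interior.mem_nhds hz)).and
      self_mem_nhdsWithin).exists
    refine ⟨_, interior_subset ht, ?_⟩
    rw [add_sub_right_comm, map_add, hLz, map_smul, hLf]
    simpa using ht0
  obtain ⟨a, ha, p, hp, hpeq, hple⟩ := exists_tangent_functional hKc L (S + m • L) u hm hL
  obtain ⟨b, hb, p', hp', hpeq', hple'⟩ := exists_tangent_functional hKc L (-S + n • L) v hn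
    (by simpa only [hLv] using hL)
  have hMp := hm p hp
  have hNp' := hn p' hp'
  have hLp : 0 < L (p - u) := hpeq ▸ mul_pos ha hMp
  have hLp' : 0 < L (p' - u) := by
    rw [← hLv, hpeq']
    exact mul_pos hb hNp'
  simp only [add_apply, smul_apply,
    neg_apply, smul_eq_mul, hSv, hLv] at hpeq hple hpeq' hple'
  have hD : 0 < 1 / a + 1 / b - (m + n) := by
    have : 0 < 1 / a + 1 / b := by positivity
    linarith
  obtain ⟨l, hl⟩ : ∃ l, l = 1 / (1 / a + 1 / b - (m + n)) := ⟨_, rfl⟩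
  have hl0 : 0 < l := by rw [hl]; positivity
  have hlD : l * (1 / a + 1 / b - (m + n)) = 1 := by
    rw [hl, one_div_mul_cancel hD.ne']
  obtain ⟨q, hq⟩ : ∃ q, q = u + ((l * (1 / a - m)) • e + l • f) := ⟨_, rfl⟩
  have hSq : S (q - u) = l * (1 / a - m) := by simp [hq, hSe, hSf]
  have hLq : L (q - u) = l := by simp [hq, hLe, hLf]
  -- The coordinates of any point of either tangent line are determined by `L`.
  have hSline : ∀ y, L (y - u) = a * (S (y - u) + m * L (y - u)) →
      S (y - u) = L (y - u) * (1 / a - m) := fun y hy => by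
    have : S (y - u) + m * L (y - u) = L (y - u) / a := by rw [eq_div_iff ha.ne']; linarith
    linear_combination this
  have hSline' : ∀ y, L (y - u) = b * (-(S (y - u) - 1) + n * L (y - u)) →
      S (y - u) - 1 = -(L (y - u) * (1 / b - n)) := fun y hy => by
    have : -(S (y - u) - 1) + n * L (y - u) = L (y - u) / b := by
      rw [eq_div_iff hb.ne']; linarith
    linear_combination -this
  have hSq' : S (q - u) - 1 = -(l * (1 / b - n)) := by
    rw [hSq]; linear_combination hlD
  have hqa : L (q - u) = a * (S (q - u) + m * L (q - u)) := by
    rw [hSq, hLq]; field_simp; ring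
  have hqb : L (q - u) = b * (-(S (q - u) - 1) + n * L (q - u)) := by
    rw [hSq', hLq]; field_simp; ring
  have hqK : q ∉ K := by
    intro hqK
    have hφ : ∀ y ∈ K, (L - a • (S + m • L)) y ≤ (L - a • (S + m • L)) q := fun y hy => by
      have := hple y hy
      simp only [map_sub] at this hqa
      simp only [sub_apply, add_apply,
        smul_apply, smul_eq_mul]
      linarith
    have hψ : ∀ y ∈ K, (L - b • (-S + n • L)) y ≤ (L - b • (-S + n • L)) q := fun y hy => by
      have := hple' y hy
      simp only [map_sub] at this hqb
      simp only [sub_apply, add_apply,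
        neg_apply, smul_apply, smul_eq_mul]
      linarith
    have hφe : (L - a • (S + m • L)) e = -a := by simp [hLe, hSe]
    have hψe : (L - b • (-S + n • L)) e = b := by simp [hLe, hSe]
    have hqf : q ∈ frontier K := by
      refine ⟨subset_closure hqK, fun hqi => ?_⟩
      have htend : Tendsto (fun t : ℝ => q - t • e) (𝓝[>] 0) (𝓝 q) := by
        have : ContinuousAt (fun t : ℝ => q - t • e) 0 := by fun_prop
        simpa [ContinuousAt] using this.tendsto.mono_left nhdsWithin_le_nhds
      obtain ⟨t, ht, ht0⟩ := ((htend.eventually (isOpen_interior.mem_nhds hqi)).and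
        self_mem_nhdsWithin).exists
      have := hφ _ (interior_subset ht)
      rw [map_sub, map_smul, hφe, smul_eq_mul] at this
      have := mul_pos (Set.mem_Ioi.1 ht0) ha
      linarith
    obtain ⟨c, hc, h⟩ := hsmooth q hqf (L - a • (S + m • L) : E →L[ℝ] ℝ).toLinearMap
      (L - b • (-S + n • L) : E →L[ℝ] ℝ).toLinearMap
      (fun h => by
        have := LinearMap.congr_fun h e
        rw [ContinuousLinearMap.coe_coe, hφe, LinearMap.zero_apply] at this
        linarith)
      (fun h => by
        have := LinearMap.congr_fun h e
        rw [ContinuousLinearMap.coe_coe, hψe, LinearMap.zero_apply] at this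
        linarith) hφ hψ
    have := LinearMap.congr_fun h e
    rw [LinearMap.smul_apply, ContinuousLinearMap.coe_coe, ContinuousLinearMap.coe_coe, hφe, hψe,
      smul_eq_mul] at this
    nlinarith [mul_pos hc ha]
  have hSp := hSline p hpeq
  have hSp' := hSline' p' hpeq'
  have hpl : L (p - u) < l := by
    refine lt_of_le_of_ne ?_ fun h => hqK ?_
    · have h := hple' p hp
      rw [← div_le_iff₀' hb, hSp] at h
      have : L (p - u) * (1 / a + 1 / b - (m + n)) ≤ 1 := by
        have : L (p - u) / b = L (p - u) * (1 / b) := by ring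
        linarith
      rwa [hl, le_div_iff₀ hD]
    · rwa [hinj q p (by rw [hSq, hSp, h]) (by rw [hLq, h])]
  have hpl' : L (p' - u) < l := by
    refine lt_of_le_of_ne ?_ fun h => hqK ?_
    · have h := hple p' hp'
      rw [← div_le_iff₀' ha] at h
      have : L (p' - u) * (1 / a + 1 / b - (m + n)) ≤ 1 := by
        have : L (p' - u) / a = L (p' - u) * (1 / a) := by ring
        linarith
      rwa [hl, le_div_iff₀ hD]
    · rwa [hinj q p' (by rw [← sub_left_inj (a := (1 : ℝ)), hSq', hSp', h]) (by rw [hLq, h])]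
  have hpseg : p ∈ openSegment ℝ u q := by
    rw [openSegment_eq_image']
    refine ⟨L (p - u) / l, ⟨by positivity, (div_lt_one hl0).2 hpl⟩, hinj _ _ ?_ ?_⟩
    · simp only [add_sub_cancel_left, map_smul, smul_eq_mul, hSq, hSp]
      field_simp
    · simp only [add_sub_cancel_left, map_smul, smul_eq_mul, hLq]
      field_simp
  have hpseg' : p' ∈ openSegment ℝ v q := by
    rw [openSegment_eq_image']
    refine ⟨L (p' - u) / l, ⟨by positivity, (div_lt_one hl0).2 hpl'⟩, hinj _ _ ?_ ?_⟩
    · rw [← sub_left_inj (a := (1 : ℝ)), ← hSv, ← hSv, hSv p', hSp', add_sub_cancel_left, map_smul,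
        hSv q, hSq', smul_eq_mul]
      field_simp
    · rw [← hLv, add_sub_cancel_left, map_smul, hLv, hLq, smul_eq_mul]
      field_simp
  obtain ⟨t, ht, ht01⟩ : ∃ t : ℝ, (1 - t) • q + t • z ∉ K ∧ t ∈ Ioo (0 : ℝ) 1 := by
    have htend : Tendsto (fun t : ℝ => (1 - t) • q + t • z) (𝓝[>] 0) (𝓝 q) := by
      have : ContinuousAt (fun t : ℝ => (1 - t) • q + t • z) 0 := by fun_prop
      simpa [ContinuousAt] using this.tendsto.mono_left nhdsWithin_le_nhds
    exact ((htend.eventually (hKc.isClosed.isOpen_compl.mem_nhds hqK)).and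
      (Ioo_mem_nhdsGT one_pos)).exists
  have hwseg : (1 - t) • q + t • z ∈ openSegment ℝ q z := by
    rw [openSegment_eq_image]
    exact ⟨t, ht01, rfl⟩
  refine ⟨_, ht, ?_, ?_, ?_⟩
  · have : (1 - t) • q + t • z - u = (1 - t) • (q - u) + t • (z - u) := by module
    rw [this, map_add, map_smul, map_smul, hLz, hLq, smul_zero, add_zero, smul_eq_mul]
    exact mul_pos (sub_pos.2 ht01.2) hl0
  · exact (openSegment_inter_openSegment_of_mem hpseg hwseg).mono
      (inter_subset_inter_right _ (hK.openSegment_self_interior_subset_interior hp hz))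
  · rw [openSegment_symm ℝ _ v]
    exact (openSegment_inter_openSegment_of_mem hpseg' hwseg).mono
      (inter_subset_inter_right _ (hK.openSegment_self_interior_subset_interior hp' hz))

/-- Coordinates on the plane whose first axis is a given nonzero vector. -/
theorem exists_coordinates_of_ne_zero {e : EuclideanSpace ℝ (Fin 2)} (he : e ≠ 0) :
    ∃ (S L : EuclideanSpace ℝ (Fin 2) →L[ℝ] ℝ) (f : EuclideanSpace ℝ (Fin 2)),
      (∀ x, x = S x • e + L x • f) ∧ S e = 1 ∧ S f = 0 ∧ L e = 0 ∧ L f = 1 := by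
  have hd : e 0 * e 0 + e 1 * e 1 ≠ 0 := fun h => he <| by
    have h₀ : e 0 = 0 := by nlinarith [mul_self_nonneg (e 0), mul_self_nonneg (e 1)]
    have h₁ : e 1 = 0 := by nlinarith [mul_self_nonneg (e 0), mul_self_nonneg (e 1)]
    ext i
    fin_cases i <;> simpa
  let P (i : Fin 2) : EuclideanSpace ℝ (Fin 2) →L[ℝ] ℝ := EuclideanSpace.proj i
  obtain ⟨d, hde⟩ : ∃ d, d = e 0 * e 0 + e 1 * e 1 := ⟨_, rfl⟩
  rw [← hde] at hd
  refine ⟨d⁻¹ • (e 0 • P 0 + e 1 • P 1), d⁻¹ • (e 0 • P 1 - e 1 • P 0), !₂[-e 1, e 0],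
    fun x => ?_, ?_, ?_, ?_, ?_⟩
  · ext i
    fin_cases i <;> simp [P] <;> field_simp <;> rw [hde] <;> ring
  · simp [P, ← mul_add, ← hde, hd]
  · simp [P, mul_comm]
  · simp [P, mul_comm]
  · simp [P, ← hde, hd]

/-- Ear placement for a smooth convex body: if `u, v` lie outside a compact
convex set `K` with nonempty interior having a unique supporting line at each
frontier point, and the open segment `uv` meets the interior of `K`, then
there is an apex `w` outside `K`, not on the line `uv`, such that both open
segments `uw` and `wv` meet the interior of `K`. -/
theorem ear_apex_exists_for_smooth_convex_body
    (K : Set (EuclideanSpace ℝ (Fin 2))) (hKc : IsCompact K) (hK : Convex ℝ K)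
    (hint : (interior K).Nonempty)
    (hsmooth : ∀ x ∈ frontier K,
      ∀ φ ψ : EuclideanSpace ℝ (Fin 2) →ₗ[ℝ] ℝ, φ ≠ 0 → ψ ≠ 0 →
        (∀ y ∈ K, φ y ≤ φ x) → (∀ y ∈ K, ψ y ≤ ψ x) → ∃ c > (0 : ℝ), ψ = c • φ)
    (u v : EuclideanSpace ℝ (Fin 2)) (hu : u ∉ K) (hv : v ∉ K)
    (huv : (openSegment ℝ u v ∩ interior K).Nonempty) :
    ∃ w : EuclideanSpace ℝ (Fin 2), w ∉ K ∧
      ¬ Collinear ℝ ({u, v, w} : Set (EuclideanSpace ℝ (Fin 2))) ∧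
      (openSegment ℝ u w ∩ interior K).Nonempty ∧
      (openSegment ℝ w v ∩ interior K).Nonempty := by
  obtain ⟨z, hzseg, hz⟩ := huv
  have hzK := interior_subset hz
  rw [openSegment_eq_image'] at hzseg
  obtain ⟨r, ⟨hr0, hr1⟩, hzr⟩ := hzseg
  have hne : v - u ≠ 0 := fun h => hu <| by
    have : u = z := by simpa [h] using hzr
    rwa [this]
  obtain ⟨S, L, f, hdec, hSe, hSf, hLe, hLf⟩ := exists_coordinates_of_ne_zero hne
  have hvu : v = u + (v - u) := (add_sub_cancel u v).symm
  have hzu : z - u = r • (v - u) := by rw [← hzr]; exact add_sub_cancel_left _ _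
  have hzv : z - v = (r - 1) • (v - u) := by rw [← hzr]; module
  have hLzu : L (z - u) = 0 := by rw [hzu, map_smul, hLe, smul_zero]
  have hLzv : L (z - v) = 0 := by rw [hzv, map_smul, hLe, smul_zero]
  obtain ⟨m, hm⟩ := exists_separating_coordinate hKc.isClosed hK hdec hu hzK hLzu
    (by rw [hzu, map_smul, hSe]; simpa using hr0)
  obtain ⟨n, hn⟩ := exists_separating_coordinate hKc.isClosed hK (S := -S) (e := -(v - u))
    (f := f)
    (fun x => by simpa only [neg_apply, neg_smul_neg] using hdec x) hv hzK hLzv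
    (by rw [hzv, map_smul, neg_apply, hSe]; simpa using hr1)
  obtain ⟨w, hwK, hLw, huw, hwv⟩ : ∃ w, w ∉ K ∧ L (w - u) ≠ 0 ∧
      (openSegment ℝ u w ∩ interior K).Nonempty ∧
      (openSegment ℝ w v ∩ interior K).Nonempty := by
    rcases le_total (m + n) 0 with hmn | hmn
    · obtain ⟨w, hwK, hLw, h⟩ := exists_apex_of_nonpos hKc hK hsmooth hdec hSe hSf hLe hLf hvu hz
        hLzu hm hn hmn
      exact ⟨w, hwK, hLw.ne', h⟩
    · obtain ⟨w, hwK, hLw, h⟩ := exists_apex_of_nonpos hKc hK hsmooth (L := -L) (f := -f)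
        (m := -m) (n := -n) (fun x => by simpa using hdec x) hSe (by simpa using hSf)
        (by rw [neg_apply, hLe, neg_zero]) (by simpa using hLf) hvu hz
        (by rw [neg_apply, hLzu, neg_zero])
        (by simpa using hm) (by simpa using hn) (by linarith)
      exact ⟨w, hwK, (neg_pos.1 hLw).ne, h⟩
  refine ⟨w, hwK, fun hcol => hLw ?_, huw, hwv⟩
  obtain ⟨d, hd⟩ := (collinear_iff_of_mem (p₀ := u) (by simp)).1 hcol
  obtain ⟨r₁, h₁⟩ := hd v (by simp)
  obtain ⟨r₂, h₂⟩ := hd w (by simp)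
  rw [vadd_eq_add, ← sub_eq_iff_eq_add] at h₁ h₂
  have hr₁ : r₁ ≠ 0 := fun h => hne (by rw [h₁, h, zero_smul])
  have hLd : L d = 0 := by
    rw [h₁, map_smul, smul_eq_mul] at hLe
    exact (mul_eq_zero.1 hLe).resolve_left hr₁
  rw [h₂, map_smul, hLd, smul_zero]
end
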